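/- Let V be a real normed vector space, let p, q ∈ V and let r, s > 0 be real numbers with ‖p − q‖ = r + s. Then the point u = (s/(r+s))•p + (r/(r+s))•q lies in S_V(p, r) ∩ S_V(q, s); moreover, if x ∈ S_V(p, r) ∩ S_V(q, s) and x − p is a rotund point of V, then x = u. -/

import Mathlib

/-- A point `v` of a real normed vector space is *rotund* if for every `w`,
`‖w‖ = ‖v‖` and `‖(w+v)/2‖ = ‖v‖` imply `w = v`. -/
def Rotund {V : Type*} [NormedAddCommGroup V] [NormedSpace ℝ V] (v : V) : Prop :=
  ∀ w : V, ‖w‖ = ‖v‖ → ‖((1 : ℝ) / 2) • (w + v)‖ = ‖v‖ → w = v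

/-- if `‖p - q‖ = r + s` with `r, s > 0`, then
`u = (s/(r+s))•p + (r/(r+s))•q` lies on `S_V(p,r) ∩ S_V(q,s)`, and any point `x` of
that intersection with `x - p` rotund equals `u`. -/
theorem stmt_16 {V : Type*} [NormedAddCommGroup V] [NormedSpace ℝ V]
    (p q : V) (r s : ℝ) (hr : 0 < r) (hs : 0 < s) (hpq : ‖p - q‖ = r + s) :
    (‖((s / (r + s)) • p + (r / (r + s)) • q) - p‖ = r ∧
     ‖((s / (r + s)) • p + (r / (r + s)) • q) - q‖ = s) ∧
    ∀ x : V, ‖x - p‖ = r → ‖x - q‖ = s → Rotund (x - p) →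
      x = (s / (r + s)) • p + (r / (r + s)) • q := by
  have hrs : 0 < r + s := add_pos hr hs
  have hqp : ‖q - p‖ = r + s := by rw [norm_sub_rev, hpq]
  have hup : ‖((s / (r + s)) • p + (r / (r + s)) • q) - p‖ = r := by
    have h : ((s / (r + s)) • p + (r / (r + s)) • q) - p = (r / (r + s)) • (q - p) := by
      match_scalars <;> field_simp
      ring
    rw [h, norm_smul, hqp, Real.norm_of_nonneg (by positivity)]
    field_simp
  have huq : ‖((s / (r + s)) • p + (r / (r + s)) • q) - q‖ = s := by
    have h : ((s / (r + s)) • p + (r / (r + s)) • q) - q = (s / (r + s)) • (p - q) := by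
      match_scalars <;> field_simp
      ring
    rw [h, norm_smul, hpq, Real.norm_of_nonneg (by positivity)]
    field_simp
  refine ⟨⟨hup, huq⟩, fun x hxp hxq hx => ?_⟩
  generalize (s / (r + s)) • p + (r / (r + s)) • q = u at hup huq ⊢
  have norm_midpoint_le (a b : V) : ‖((1 : ℝ) / 2) • (a + b)‖ ≤ (‖a‖ + ‖b‖) / 2 := by
    rw [norm_smul, Real.norm_of_nonneg (by norm_num)]
    linarith [norm_add_le a b]
  have hp := norm_midpoint_le (u - p) (x - p)
  have hq := norm_midpoint_le (u - q) (x - q)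
  have hsum := norm_sub_le (((1 : ℝ) / 2) • ((u - p) + (x - p)))
    (((1 : ℝ) / 2) • ((u - q) + (x - q)))
  have hdiff : ((1 : ℝ) / 2) • ((u - p) + (x - p)) - ((1 : ℝ) / 2) • ((u - q) + (x - q))
      = q - p := by
    module
  rw [hdiff, hqp] at hsum
  rw [hup, hxp] at hp
  rw [huq, hxq] at hq
  exact (sub_left_injective (hx (u - p) (hup.trans hxp.symm) (by rw [hxp]; linarith))).symm
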